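/- For all 0 ≤ s ≤ t ≤ T and x ∈ Ω, the value function satisfies the dynamic programming principle v(s,x) = inf_{a∈𝒜} [ ∫_s^t χ^{s,x,a}(r) ℓ^{s,x,a}(r) dr + χ^{s,x,a}(t) v(t,φ^{s,x,a}) ]. -/

import Mathlib

open MeasureTheory Set Filter Topology
open scoped InnerProductSpace

noncomputable section

namespace PHJ

/-- The Euclidean state space `ℝ^d`. -/
abbrev E (d : ℕ) := EuclideanSpace ℝ (Fin d)

/-- A path; only its values on `[0, T]` are relevant. -/
abbrev Path (d : ℕ) := ℝ → E d

/-- The set `Ω = D([0,T], ℝ^d)` of paths that are right-continuous on `[0,T)` and have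
left limits on `(0,T]`. -/
def Cadlag (T : ℝ) (d : ℕ) : Set (Path d) :=
  {x | (∀ t ∈ Ico (0 : ℝ) T, ContinuousWithinAt x (Ici t) t) ∧
       (∀ t ∈ Ioc (0 : ℝ) T, ∃ l : E d, Tendsto x (nhdsWithin t (Iio t)) (nhds l))}

/-- The running supremum `sup_{0 ≤ s ≤ t} |x(s)|`. -/
def runSup (d : ℕ) (x : Path d) (t : ℝ) : ℝ :=
  sSup ((fun s => ‖x s‖) '' Icc 0 t)

/-- The supremum distance `sup_{0 ≤ s ≤ T} |x(s) − y(s)|`. -/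
def supDist (T : ℝ) (d : ℕ) (x y : Path d) : ℝ :=
  sSup ((fun s => ‖x s - y s‖) '' Icc 0 T)

/-- The stopped supremum distance `sup_{0 ≤ r ≤ T} |x(r ∧ t) − y(r ∧ s)|`. -/
def stopDist (T : ℝ) (d : ℕ) (t : ℝ) (x : Path d) (s : ℝ) (y : Path d) : ℝ :=
  sSup ((fun r => ‖x (min r t) - y (min r s)‖) '' Icc 0 T)

/-- The pseudometric `d_∞` on `[0,T] × Ω`. -/
def dInf (T : ℝ) (d : ℕ) (p q : ℝ × Path d) : ℝ :=
  |p.1 - q.1| + stopDist T d p.1 p.2 q.1 q.2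

/-- `g` is an integrable a.e.-derivative of `x` on `[s₀, T]` (so that `x` is absolutely
continuous there) satisfying the growth bound `|x′(t)| ≤ L (1 + sup_{s ≤ t} |x(s)|)` a.e. -/
def XDeriv (T : ℝ) (d : ℕ) (L s₀ : ℝ) (x g : Path d) : Prop :=
  IntegrableOn g (Icc s₀ T) volume ∧
  (∀ t ∈ Icc s₀ T, x t = x s₀ + ∫ s in s₀..t, g s) ∧
  (∀ᵐ t ∂(volume.restrict (Ioo s₀ T)), ‖g t‖ ≤ L * (1 + runSup d x t))

/-- The set `X^L(s₀, x₀)` of "Lipschitz-like" paths. -/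
def XSet (T : ℝ) (d : ℕ) (L s₀ : ℝ) (x₀ : Path d) : Set (Path d) :=
  {x | x ∈ Cadlag T d ∧ (∀ t ∈ Icc 0 s₀, x t = x₀ t) ∧ ∃ g, XDeriv T d L s₀ x g}

/-- Type of Hamiltonians `H(t, x, y, z)`. -/
abbrev Ham (d : ℕ) := ℝ → Path d → ℝ → E d → ℝ

/-- The set `Y^L(s₀, x₀, y₀, z)` of characteristic pairs `(x, y)`. -/
def YSet (T : ℝ) (d : ℕ) (H : Ham d) (L s₀ : ℝ) (x₀ : Path d) (y₀ : ℝ) (z : E d) :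
    Set (Path d × (ℝ → ℝ)) :=
  {p | p.1 ∈ Cadlag T d ∧ (∀ t ∈ Icc 0 s₀, p.1 t = x₀ t) ∧
       ContinuousOn p.2 (Icc s₀ T) ∧
       ∃ g, XDeriv T d L s₀ p.1 g ∧
         IntegrableOn (fun s => ⟪g s, z⟫_ℝ - H s p.1 (p.2 s) z) (Icc s₀ T) volume ∧
         ∀ t ∈ Icc s₀ T, p.2 t = y₀ + ∫ s in s₀..t, (⟪g s, z⟫_ℝ - H s p.1 (p.2 s) z)}

/-- Assumption (i): for a.e. `t`, `(x, y, z) ↦ H(t, x, y, z)` is continuous. -/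
def HamCont (T : ℝ) (d : ℕ) (H : Ham d) : Prop :=
  ∀ᵐ t ∂(volume.restrict (Ioo (0 : ℝ) T)),
    ∀ x ∈ Cadlag T d, ∀ (y : ℝ) (z : E d), ∀ ε > (0 : ℝ), ∃ δ > (0 : ℝ),
      ∀ x' ∈ Cadlag T d, ∀ (y' : ℝ) (z' : E d),
        supDist T d x x' < δ → |y - y'| < δ → ‖z - z'‖ < δ →
        |H t x y z - H t x' y' z'| < ε

/-- Assumption (ii): `t ↦ H(t, x, y, z)` is Borel measurable. -/
def HamMeas (d : ℕ) (H : Ham d) : Prop :=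
  ∀ (x : Path d) (y : ℝ) (z : E d), Measurable fun t => H t x y z

/-- Assumption (iii): Lipschitz continuity in `z` with constant `L_H (1 + sup_{s≤t} |x(s)|)`. -/
def HamLipZ (T : ℝ) (d : ℕ) (H : Ham d) (LH : ℝ) : Prop :=
  0 ≤ LH ∧ ∀ᵐ t ∂(volume.restrict (Ioo (0 : ℝ) T)),
    ∀ x ∈ Cadlag T d, ∀ (y : ℝ) (z z' : E d),
      |H t x y z - H t x y z'| ≤ LH * (1 + runSup d x t) * ‖z - z'‖

/-- Assumption (iv): local Lipschitz continuity in `x` along `X^L`-paths,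
with constant `M L`. -/
def HamLipX (T : ℝ) (d : ℕ) (H : Ham d) (M : ℝ → ℝ) : Prop :=
  ∀ L ≥ (0 : ℝ), 0 ≤ M L ∧
    ∀ t₀ ∈ Ico (0 : ℝ) T, ∀ x₀ ∈ Cadlag T d,
      ∀ x ∈ XSet T d L t₀ x₀, ∀ x' ∈ XSet T d L t₀ x₀, ∀ (y : ℝ) (z : E d),
        ∀ᵐ t ∂(volume.restrict (Ioo t₀ T)),
          |H t x y z - H t x' y z| ≤
            M L * (1 + |y| + ‖z‖) * sSup ((fun s => ‖x s - x' s‖) '' Icc 0 t)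

/-- Assumption (v): `y ↦ H(t, x, y, z)` is non-increasing. -/
def HamMono (T : ℝ) (d : ℕ) (H : Ham d) : Prop :=
  ∀ᵐ t ∂(volume.restrict (Ioo (0 : ℝ) T)),
    ∀ x ∈ Cadlag T d, ∀ (z : E d) (y y' : ℝ), y ≤ y' → H t x y' z ≤ H t x y z

/-- Assumption (vi): growth bound `|H(t, x, y, 0)| ≤ C_H (1 + sup_{s≤t}|x(s)| + |y|)`. -/
def HamBound (T : ℝ) (d : ℕ) (H : Ham d) (CH : ℝ) : Prop :=
  0 ≤ CH ∧ ∀ᵐ t ∂(volume.restrict (Ioo (0 : ℝ) T)),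
    ∀ x ∈ Cadlag T d, ∀ y : ℝ, |H t x y 0| ≤ CH * (1 + runSup d x t + |y|)

/-- Lower semicontinuity on `[0,T] × Ω` with respect to `d_∞`. -/
def LscOn (T : ℝ) (d : ℕ) (u : ℝ → Path d → ℝ) : Prop :=
  ∀ t₀ ∈ Icc (0 : ℝ) T, ∀ x₀ ∈ Cadlag T d, ∀ c : ℝ, c < u t₀ x₀ →
    ∃ δ > (0 : ℝ), ∀ t ∈ Icc (0 : ℝ) T, ∀ x ∈ Cadlag T d,
      dInf T d (t₀, x₀) (t, x) < δ → c < u t x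

/-- Upper semicontinuity on `[0,T] × Ω` with respect to `d_∞`. -/
def UscOn (T : ℝ) (d : ℕ) (u : ℝ → Path d → ℝ) : Prop :=
  ∀ t₀ ∈ Icc (0 : ℝ) T, ∀ x₀ ∈ Cadlag T d, ∀ c : ℝ, u t₀ x₀ < c →
    ∃ δ > (0 : ℝ), ∀ t ∈ Icc (0 : ℝ) T, ∀ x ∈ Cadlag T d,
      dInf T d (t₀, x₀) (t, x) < δ → u t x < c

/-- Continuity of the terminal condition `h` with respect to the sup norm. -/
def TermCont (T : ℝ) (d : ℕ) (h : Path d → ℝ) : Prop :=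
  ∀ x ∈ Cadlag T d, ∀ ε > (0 : ℝ), ∃ δ > (0 : ℝ), ∀ x' ∈ Cadlag T d,
    supDist T d x x' < δ → |h x' - h x| < ε

/-- `u` is a minimax `L`-supersolution of the terminal-value problem (TVP). -/
def MinimaxSuper (T : ℝ) (d : ℕ) (H : Ham d) (h : Path d → ℝ) (L : ℝ)
    (u : ℝ → Path d → ℝ) : Prop :=
  LscOn T d u ∧ (∀ x ∈ Cadlag T d, h x ≤ u T x) ∧
  ∀ s₀ ∈ Ico (0 : ℝ) T, ∀ x₀ ∈ Cadlag T d, ∀ (z : E d) (y₀ : ℝ), u s₀ x₀ ≤ y₀ →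
    ∃ p ∈ YSet T d H L s₀ x₀ y₀ z, ∀ t ∈ Icc s₀ T, u t p.1 ≤ p.2 t

/-- `u` is a minimax `L`-subsolution of the terminal-value problem (TVP). -/
def MinimaxSub (T : ℝ) (d : ℕ) (H : Ham d) (h : Path d → ℝ) (L : ℝ)
    (u : ℝ → Path d → ℝ) : Prop :=
  UscOn T d u ∧ (∀ x ∈ Cadlag T d, u T x ≤ h x) ∧
  ∀ s₀ ∈ Ico (0 : ℝ) T, ∀ x₀ ∈ Cadlag T d, ∀ (z : E d) (y₀ : ℝ), y₀ ≤ u s₀ x₀ →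
    ∃ p ∈ YSet T d H L s₀ x₀ y₀ z, ∀ t ∈ Icc s₀ T, p.2 t ≤ u t p.1

/-- `u` is a minimax `L`-solution of the terminal-value problem (TVP). -/
def MinimaxSol (T : ℝ) (d : ℕ) (H : Ham d) (h : Path d → ℝ) (L : ℝ)
    (u : ℝ → Path d → ℝ) : Prop :=
  MinimaxSuper T d H h L u ∧ MinimaxSub T d H h L u

/-- Embedding of a path into the space of functions on `[0,T]` with the topology of
uniform convergence (i.e. the sup-norm topology). -/
def toUnif (T : ℝ) (d : ℕ) (x : Path d) : UniformFun (Icc (0 : ℝ) T) (E d) :=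
  UniformFun.ofFun fun s => x s.1

/-- Embedding of a real-valued function into the space of functions on `[s₀,T]` with the
topology of uniform convergence. -/
def toUnifR (T s₀ : ℝ) (y : ℝ → ℝ) : UniformFun (Icc s₀ T) ℝ :=
  UniformFun.ofFun fun s => y s.1


/-- Continuity on `[0,T] × Ω` with respect to `d_∞`. -/
def Cont2 (T : ℝ) (d : ℕ) (u : ℝ → Path d → ℝ) : Prop :=
  ∀ t₀ ∈ Icc (0 : ℝ) T, ∀ x₀ ∈ Cadlag T d, ∀ ε > (0 : ℝ), ∃ δ > (0 : ℝ),
    ∀ t ∈ Icc (0 : ℝ) T, ∀ x ∈ Cadlag T d,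
      dInf T d (t₀, x₀) (t, x) < δ → |u t x - u t₀ x₀| < ε

/-- `A` is a countable union of compact metrizable subsets. -/
def SigmaCompactMetrizable (A : Type*) [TopologicalSpace A] : Prop :=
  ∃ K : ℕ → Set A, (∀ n, IsCompact (K n)) ∧
    (∀ n, TopologicalSpace.MetrizableSpace (K n)) ∧ (⋃ n, K n) = univ

section Control

variable (T : ℝ) (d : ℕ) (A : Type*) [TopologicalSpace A] [MeasurableSpace A]

/-- The set `𝒜` of Borel measurable controls. -/
def CtrlSet : Set (ℝ → A) := {α | Measurable α}

variable {A}

/-- Assumption (i) on the data: joint continuity in `(x, a)` for a.e. `t`. -/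
def DocCont (f : ℝ → Path d → A → E d) (lam ell : ℝ → Path d → A → ℝ) : Prop :=
  ∀ᵐ t ∂(volume.restrict (Ioo (0 : ℝ) T)),
    ∀ x ∈ Cadlag T d, ∀ a : A, ∀ ε > (0 : ℝ), ∃ δ > (0 : ℝ), ∃ U ∈ nhds a,
      ∀ x' ∈ Cadlag T d, ∀ a' ∈ U, supDist T d x x' < δ →
        ‖f t x a - f t x' a'‖ < ε ∧ |lam t x a - lam t x' a'| < ε ∧
          |ell t x a - ell t x' a'| < ε

/-- Assumption (ii) on the data: Borel measurability in `t`. -/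
def DocMeas (f : ℝ → Path d → A → E d) (lam ell : ℝ → Path d → A → ℝ) : Prop :=
  ∀ (x : Path d) (a : A), Measurable (fun t => f t x a) ∧
    Measurable (fun t => lam t x a) ∧ Measurable (fun t => ell t x a)

/-- Assumption (iii) on the data: growth bounds with constants `C_f` and `C_λ`;
also `λ ≥ 0`. -/
def DocBound (f : ℝ → Path d → A → E d) (lam ell : ℝ → Path d → A → ℝ)
    (Cf Clam : ℝ) : Prop :=
  0 ≤ Cf ∧ 0 ≤ Clam ∧
  ∀ᵐ t ∂(volume.restrict (Ioo (0 : ℝ) T)), ∀ x ∈ Cadlag T d, ∀ a : A,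
    ‖f t x a‖ + |ell t x a| ≤ Cf * (1 + runSup d x t) ∧
      0 ≤ lam t x a ∧ lam t x a ≤ Clam

/-- Assumption (iv) on the data: Lipschitz continuity in `x` with constant `L_f`. -/
def DocLip (f : ℝ → Path d → A → E d) (lam ell : ℝ → Path d → A → ℝ) (Lf : ℝ) : Prop :=
  0 ≤ Lf ∧
  ∀ᵐ t ∂(volume.restrict (Ioo (0 : ℝ) T)), ∀ x ∈ Cadlag T d, ∀ x' ∈ Cadlag T d, ∀ a : A,
    ‖f t x a - f t x' a‖ + |ell t x a - ell t x' a| + |lam t x a - lam t x' a| ≤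
      Lf * sSup ((fun s => ‖x s - x' s‖) '' Icc 0 t)

/-- `φ` is the controlled trajectory started at `(t₀, x₀)` under the control `α`:
`φ = x₀` on `[0,t₀]`, `φ` is absolutely continuous on `[t₀,T]`, and
`φ′(t) = f(t, φ, α(t))` a.e. on `(t₀,T)`. -/
def IsTraj (f : ℝ → Path d → A → E d) (t₀ : ℝ) (x₀ : Path d) (α : ℝ → A)
    (φ : Path d) : Prop :=
  (∀ t ∈ Icc 0 t₀, φ t = x₀ t) ∧
  IntegrableOn (fun s => f s φ (α s)) (Icc t₀ T) volume ∧
  ∀ t ∈ Icc t₀ T, φ t = x₀ t₀ + ∫ s in t₀..t, f s φ (α s)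

/-- The discount factor `χ^{s,x,α}(t) = exp(−∫_s^t λ(r, φ^{s,x,α}, α(r)) dr)`, where the
trajectory map `Φ` assigns to `(s, x, α)` the trajectory `φ^{s,x,α}`. -/
def chi (lam : ℝ → Path d → A → ℝ) (Φ : ℝ → Path d → (ℝ → A) → Path d)
    (s : ℝ) (x : Path d) (α : ℝ → A) (t : ℝ) : ℝ :=
  Real.exp (-∫ r in s..t, lam r (Φ s x α) (α r))

/-- The cost functional of the control problem. -/
def cost (lam ell : ℝ → Path d → A → ℝ) (h : Path d → ℝ)
    (Φ : ℝ → Path d → (ℝ → A) → Path d) (s : ℝ) (x : Path d) (α : ℝ → A) : ℝ :=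
  (∫ t in s..T, chi d lam Φ s x α t * ell t (Φ s x α) (α t)) +
    chi d lam Φ s x α T * h (Φ s x α)

variable (A)

/-- The value function `v(s,x) = inf_{α ∈ 𝒜} cost(s,x,α)`. -/
def value (lam ell : ℝ → Path d → A → ℝ) (h : Path d → ℝ)
    (Φ : ℝ → Path d → (ℝ → A) → Path d) (s : ℝ) (x : Path d) : ℝ :=
  sInf ((fun α => cost T d lam ell h Φ s x α) '' CtrlSet A)

variable {A}

/-- The HJB Hamiltonian `H(t,x,y,z) = inf_{a ∈ A} [ℓ(t,x,a) + f(t,x,a)·z − λ(t,x,a) y]`. -/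
def Hctrl (f : ℝ → Path d → A → E d) (lam ell : ℝ → Path d → A → ℝ) : Ham d :=
  fun t x y z => sInf (Set.range fun a : A => ell t x a + ⟪f t x a, z⟫_ℝ - lam t x a * y)

end Control


/-- Borel superposition: a Carathéodory function composed with a Borel control is Borel, for a
control space that is a countable union of compact metrizable (not necessarily Borel) subsets. -/
theorem measurable_caratheodory {A : Type*} [TopologicalSpace A] [MeasurableSpace A]
    [BorelSpace A] (hA : SigmaCompactMetrizable A) {g : ℝ → A → ℝ}
    (hc : ∀ t, Continuous (g t)) (hm : ∀ a, Measurable fun t => g t a)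
    {α : ℝ → A} (hα : Measurable α) : Measurable fun t => g t (α t) := by
  obtain ⟨K, hK, hmet, hcov⟩ := hA
  have (n : ℕ) : CompactSpace (K n) := isCompact_iff_compactSpace.1 (hK n)
  have hsc (n : ℕ) : SecondCountableTopology (K n) := by
    let := TopologicalSpace.metrizableSpaceMetric (K n)
    infer_instance
  let ρ : C(A, ℝ) → (n : ℕ) → C(K n, ℝ) := fun k n => k.restrict (K n)
  have : Nonempty (range ρ) := ⟨⟨ρ 0, 0, rfl⟩⟩
  obtain ⟨D, hD⟩ := TopologicalSpace.exists_dense_seq (range ρ)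
  choose k hk using fun j => (D j).2
  have approx (m : ℕ) (t : ℝ) : ∃ j, ∀ n ≤ m, ∀ a ∈ K n, |g t a - k j a| ≤ 1 / (m + 1 : ℝ) := by
    let G : C(A, ℝ) := ⟨g t, hc t⟩
    have hopen : IsOpen {p : range ρ | ∀ n ≤ m, dist (ρ G n) (p.1 n) < 1 / (m + 1 : ℝ)} := by
      have : {p : range ρ | ∀ n ≤ m, dist (ρ G n) (p.1 n) < 1 / (m + 1 : ℝ)} =
          ⋂ n ∈ Set.Iic m, {p : range ρ | dist (ρ G n) (p.1 n) < 1 / (m + 1 : ℝ)} := by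
        ext; simp
      rw [this]
      refine (Set.finite_Iic m).isOpen_biInter fun n _ => isOpen_lt ?_ continuous_const
      exact continuous_const.dist ((continuous_apply n).comp continuous_subtype_val)
    obtain ⟨j, hj⟩ := hD.exists_mem_open hopen ⟨⟨ρ G, G, rfl⟩, fun n _ => by
      simpa using by positivity⟩
    refine ⟨j, fun n hn a ha => ?_⟩
    have h1 := (ContinuousMap.dist_apply_le_dist (f := ρ G n) (g := (D j).1 n) ⟨a, ha⟩).trans
      (hj n hn).le
    rwa [← hk j, Real.dist_eq] at h1
  classical
  have hset (m j : ℕ) :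
      MeasurableSet {t | ∀ n ≤ m, ∀ a ∈ K n, |g t a - k j a| ≤ 1 / (m + 1 : ℝ)} := by
    have : {t | ∀ n ≤ m, ∀ a ∈ K n, |g t a - k j a| ≤ 1 / (m + 1 : ℝ)} =
        ⋂ n ∈ Set.Iic m, ⋂ a ∈ (TopologicalSpace.exists_countable_dense (K n)).choose,
          {t | |g t a - k j a| ≤ 1 / (m + 1 : ℝ)} := by
      ext t
      simp only [mem_ofPred_eq, mem_iInter, Set.mem_Iic]
      refine ⟨fun h n hn a _ => h n hn a a.2, fun h n hn a ha => ?_⟩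
      have hd := (TopologicalSpace.exists_countable_dense (K n)).choose_spec.2
      have hcl : IsClosed {a : K n | |g t a - k j a| ≤ 1 / (m + 1 : ℝ)} :=
        isClosed_le ((((hc t).comp continuous_subtype_val).sub
          ((k j).continuous.comp continuous_subtype_val)).abs) continuous_const
      have hsub := hcl.closure_subset_iff.2 (h n hn)
      exact hsub (hd.closure_eq ▸ mem_univ (⟨a, ha⟩ : K n))
    rw [this]
    refine MeasurableSet.biInter (Set.to_countable _) fun n _ => MeasurableSet.biInter
      (TopologicalSpace.exists_countable_dense (K n)).choose_spec.1 fun a _ => ?_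
    exact measurableSet_le ((hm a).sub_const _).abs measurable_const
  have hfind (m : ℕ) : Measurable fun t => Nat.find (approx m t) :=
    measurable_find (approx m) (hset m)
  refine measurable_of_tendsto_metrizable
    (f := fun m t => k (Nat.find (approx m t)) (α t)) (fun m => ?_) ?_
  · have : Measurable fun p : ℕ × A => k p.1 p.2 :=
      measurable_from_prod_countable_right fun j => (k j).continuous.measurable
    exact this.comp ((hfind m).prodMk hα)
  · refine tendsto_pi_nhds.2 fun t => ?_
    obtain ⟨n, hn⟩ := mem_iUnion.1 (hcov ▸ mem_univ (α t) : α t ∈ ⋃ n, K n)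
    rw [tendsto_iff_dist_tendsto_zero]
    refine squeeze_zero' (.of_forall fun _ => dist_nonneg) ?_
      (tendsto_one_div_add_atTop_nhds_zero_nat (𝕜 := ℝ))
    filter_upwards [eventually_ge_atTop n] with m hm
    rw [dist_comm, Real.dist_eq]
    exact Nat.find_spec (approx m t) n hm _ hn

/-- An almost-everywhere Carathéodory function composed with a Borel control is a.e. measurable. -/
theorem aestronglyMeasurable_caratheodory {A : Type*} [TopologicalSpace A] [MeasurableSpace A]
    [BorelSpace A] (hA : SigmaCompactMetrizable A) {μ : Measure ℝ} {g : ℝ → A → ℝ}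
    (hc : ∀ᵐ t ∂μ, Continuous (g t)) (hm : ∀ a, Measurable fun t => g t a)
    {α : ℝ → A} (hα : Measurable α) : AEStronglyMeasurable (fun t => g t (α t)) μ := by
  classical
  obtain ⟨N, hN, hNm, hN0⟩ := exists_measurable_superset_of_null (ae_iff.1 hc)
  have hcont : ∀ t ∉ N, Continuous (g t) := fun t ht => by
    by_contra hcon
    exact ht (hN hcon)
  have key : Measurable fun t => (if t ∈ N then fun _ => 0 else g t) (α t) := by
    refine measurable_caratheodory hA (fun t => ?_) (fun a => ?_) hα
    · split_ifs with ht
      · exact continuous_const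
      · exact hcont t ht
    · have : (fun t => (if t ∈ N then fun _ => 0 else g t) a) =
          fun t => if t ∈ N then 0 else g t a := by
        ext t; split_ifs <;> rfl
      rw [this]
      exact Measurable.ite hNm measurable_const (hm a)
  refine key.aestronglyMeasurable.congr ?_
  have : ∀ᵐ t ∂μ, t ∉ N := by rwa [ae_iff, show {t | ¬ t ∉ N} = N by ext; simp]
  filter_upwards [this] with t ht
  simp [ht]

/-- A property holding a.e. on `(0, T)` holds a.e. on any half-open subinterval. -/
theorem ae_Ioc_of_ae_Ioo {T : ℝ} {P : ℝ → Prop}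
    (hP : ∀ᵐ t ∂(volume.restrict (Ioo (0 : ℝ) T)), P t) {a b : ℝ} (ha : 0 ≤ a) (hb : b ≤ T) :
    ∀ᵐ t, t ∈ Ioc a b → P t := by
  rw [← ae_restrict_iff' measurableSet_Ioc]
  rw [Measure.restrict_congr_set Ioo_ae_eq_Ioc] at hP
  exact ae_restrict_of_ae_restrict_of_subset (Ioc_subset_Ioc ha hb) hP

/-- Càdlàg paths are bounded on `[0, T]`. -/
theorem Cadlag.exists_norm_le {T : ℝ} {d : ℕ} {x : Path d} (hx : x ∈ Cadlag T d) :
    ∃ M, 0 ≤ M ∧ ∀ t ∈ Icc 0 T, ‖x t‖ ≤ M := by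
  obtain ⟨hr, hl⟩ := hx
  have loc : ∃ M, ∀ t ∈ Icc 0 T, ‖x t‖ ≤ M := by
    refine isCompact_Icc.induction_on (p := fun S => ∃ M, ∀ t ∈ S, ‖x t‖ ≤ M) ⟨0, by simp⟩
      ?_ ?_ ?_
    · rintro S S' hSS' ⟨M, hM⟩
      exact ⟨M, fun t ht => hM t (hSS' ht)⟩
    · rintro S S' ⟨M, hM⟩ ⟨M', hM'⟩
      exact ⟨max M M', fun t ht => ht.elim (fun h => (hM t h).trans (le_max_left _ _))
        (fun h => (hM' t h).trans (le_max_right _ _))⟩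
    · intro t ht
      have hR : ∃ M, ∀ᶠ r in 𝓝 t, r ∈ Icc 0 T → t ≤ r → ‖x r‖ ≤ M := by
        rcases ht.2.lt_or_eq with htT | htT
        · have := (hr t ⟨ht.1, htT⟩).norm.eventually_le_const (lt_add_one ‖x t‖)
          rw [eventually_nhdsWithin_iff] at this
          exact ⟨_, this.mono fun r hr _ htr => hr htr⟩
        · refine ⟨‖x t‖, .of_forall fun r hr' htr => ?_⟩
          rw [show r = t by linarith [hr'.2]]
      have hL : ∃ M, ∀ᶠ r in 𝓝 t, r ∈ Icc 0 T → r < t → ‖x r‖ ≤ M := by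
        rcases ht.1.lt_or_eq with h0 | h0
        · obtain ⟨l, hl⟩ := hl t ⟨h0, ht.2⟩
          have := hl.norm.eventually_le_const (lt_add_one ‖l‖)
          rw [eventually_nhdsWithin_iff] at this
          exact ⟨_, this.mono fun r hr _ htr => hr htr⟩
        · exact ⟨0, .of_forall fun r hr' htr => by linarith [hr'.1]⟩
      obtain ⟨M, hM⟩ := hR
      obtain ⟨M', hM'⟩ := hL
      refine ⟨{r | ‖x r‖ ≤ max M M'}, ?_, max M M', fun r hr => hr⟩
      rw [mem_nhdsWithin_iff_eventually]
      filter_upwards [hM, hM'] with r h1 h2 hr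
      rcases le_or_gt t r with h | h
      · exact (h1 hr h).trans (le_max_left _ _)
      · exact (h2 hr h).trans (le_max_right _ _)
  obtain ⟨M, hM⟩ := loc
  exact ⟨max M 0, le_max_right _ _, fun t ht => (hM t ht).trans (le_max_left _ _)⟩

/-- A path that is càdlàg up to time `s` and continuous afterwards is càdlàg. -/
theorem Cadlag.of_continuousOn {T : ℝ} {d : ℕ} {x φ : Path d} (hx : x ∈ Cadlag T d) {s : ℝ}
    (heq : ∀ t ∈ Ico 0 s, φ t = x t) (hc : ContinuousOn φ (Icc s T)) : φ ∈ Cadlag T d := by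
  refine ⟨fun t ht => ?_, fun t ht => ?_⟩
  · rcases lt_or_ge t s with hts | hts
    · refine (hx.1 t ht).congr_of_eventuallyEq ?_ (heq t ⟨ht.1, hts⟩)
      filter_upwards [self_mem_nhdsWithin, mem_nhdsWithin_of_mem_nhds (Iio_mem_nhds hts)]
        with r h1 h2
      exact heq r ⟨ht.1.trans h1, h2⟩
    · refine (hc t ⟨hts, ht.2.le⟩).mono_of_mem_nhdsWithin ?_
      filter_upwards [self_mem_nhdsWithin, mem_nhdsWithin_of_mem_nhds (Iio_mem_nhds ht.2)]
        with r h1 h2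
      exact ⟨hts.trans h1, le_of_lt h2⟩
  · rcases le_or_gt t s with hts | hts
    · obtain ⟨l, hl⟩ := hx.2 t ht
      refine ⟨l, hl.congr' ?_⟩
      filter_upwards [self_mem_nhdsWithin, mem_nhdsWithin_of_mem_nhds (Ioi_mem_nhds ht.1)]
        with r h1 h2
      exact (heq r ⟨le_of_lt h2, lt_of_lt_of_le h1 hts⟩).symm
    · refine ⟨φ t, (hc t ⟨hts.le, ht.2⟩).mono_left ?_⟩
      refine nhdsWithin_le_of_mem ?_
      filter_upwards [self_mem_nhdsWithin, mem_nhdsWithin_of_mem_nhds (Ioi_mem_nhds hts)]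
        with r h1 h2
      exact ⟨le_of_lt h2, (le_of_lt h1).trans ht.2⟩

theorem IsTraj.continuousOn {T : ℝ} {d : ℕ} {A : Type*} {f : ℝ → Path d → A → E d} {s : ℝ}
    {x : Path d} {α : ℝ → A} {φ : Path d} (h : IsTraj T d f s x α φ) (hsT : s ≤ T) :
    ContinuousOn φ (Icc s T) := by
  have h1 := intervalIntegral.continuousOn_primitive_interval (a := s) (b := T)
    (f := fun r => f r φ (α r)) (μ := volume) (by rw [uIcc_of_le hsT]; exact h.2.1)
  rw [uIcc_of_le hsT] at h1
  exact (continuousOn_const.add h1).congr h.2.2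

theorem IsTraj.mem_cadlag {T : ℝ} {d : ℕ} {A : Type*} {f : ℝ → Path d → A → E d} {s : ℝ}
    {x : Path d} {α : ℝ → A} {φ : Path d} (h : IsTraj T d f s x α φ) (hsT : s ≤ T)
    (hx : x ∈ Cadlag T d) : φ ∈ Cadlag T d :=
  Cadlag.of_continuousOn hx (fun t ht => h.1 t (Ico_subset_Icc_self ht)) (h.continuousOn hsT)

theorem integral_exp_weight_le {C N : ℝ} (hC : 0 ≤ C) (hN : 0 ≤ N) (s t : ℝ) :
    ∫ r in s..t, C * (N * Real.exp ((2 * C + 1) * r)) ≤ N / 2 * Real.exp ((2 * C + 1) * t) := by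
  have hK : 0 < 2 * C + 1 := by linarith
  have hd (r : ℝ) : HasDerivAt (fun r => C * N / (2 * C + 1) * Real.exp ((2 * C + 1) * r))
      (C * (N * Real.exp ((2 * C + 1) * r))) r := by
    have := (((hasDerivAt_id r).const_mul (2 * C + 1)).exp).const_mul (C * N / (2 * C + 1))
    refine this.congr_deriv ?_
    simp only [id]
    field_simp
  rw [intervalIntegral.integral_eq_sub_of_hasDerivAt (fun r _ => hd r)
    (Continuous.intervalIntegrable (by fun_prop) _ _)]
  have h1 : 0 ≤ C * N / (2 * C + 1) * Real.exp ((2 * C + 1) * s) := by positivity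
  have h2 : C * N / (2 * C + 1) ≤ N / 2 := by
    rw [div_le_div_iff₀ hK two_pos]; nlinarith
  have h3 := mul_le_mul_of_nonneg_right h2 (Real.exp_pos ((2 * C + 1) * t)).le
  linarith

/-- Grönwall's inequality for path-dependent integrands: the integrand at time `r` is controlled
by the supremum of `u` over `[0, r]`. -/
theorem gronwall_path {F : Type*} [NormedAddCommGroup F] [NormedSpace ℝ F] {u : ℝ → ℝ}
    {g : ℝ → F} {s b C c M : ℝ} (hC : 0 ≤ C) (hc : 0 ≤ c) (hM : 0 ≤ M)
    (hbdd : ∀ t ∈ Icc 0 b, u t ≤ M) (hinit : ∀ t ∈ Icc 0 s, u t ≤ c)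
    (hint : ∀ t ∈ Icc s b, u t ≤ c + ‖∫ r in s..t, g r‖)
    (hg : ∀ᵐ r, r ∈ Ioc s b → ∀ m ≥ 0, (∀ q ∈ Icc 0 r, u q ≤ m) → ‖g r‖ ≤ C * m) :
    ∀ t ∈ Icc 0 b, u t ≤ 2 * c * Real.exp ((2 * C + 1) * t) := by
  have hw {t : ℝ} (ht : 0 ≤ t) : 1 ≤ Real.exp ((2 * C + 1) * t) := Real.one_le_exp (by positivity)
  have step (N : ℝ) (hN : 0 ≤ N) (hu : ∀ t ∈ Icc 0 b, u t ≤ N * Real.exp ((2 * C + 1) * t)) :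
      ∀ t ∈ Icc 0 b, u t ≤ (c + N / 2) * Real.exp ((2 * C + 1) * t) := by
    intro t ht
    have hcw : c ≤ c * Real.exp ((2 * C + 1) * t) := le_mul_of_one_le_right hc (hw ht.1)
    rcases le_total t s with hts | hts
    · have : 0 ≤ N / 2 * Real.exp ((2 * C + 1) * t) := by positivity
      linarith [hinit t ⟨ht.1, hts⟩]
    · have h1 : ‖∫ r in s..t, g r‖ ≤ ∫ r in s..t, C * (N * Real.exp ((2 * C + 1) * r)) := by
        refine intervalIntegral.norm_integral_le_of_norm_le hts ?_
          (Continuous.intervalIntegrable (by fun_prop) _ _)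
        filter_upwards [hg] with r hr hrt
        refine hr ⟨hrt.1, hrt.2.trans ht.2⟩ _ (by positivity) fun q hq => ?_
        refine (hu q ⟨hq.1, hq.2.trans (hrt.2.trans ht.2)⟩).trans ?_
        have := hq.2
        gcongr
      linarith [hint t ⟨hts, ht.2⟩, integral_exp_weight_le hC hN s t]
  have iter (n : ℕ) : ∀ t ∈ Icc 0 b,
      u t ≤ (2 * c + M / 2 ^ n) * Real.exp ((2 * C + 1) * t) := by
    induction n with
    | zero =>
      intro t ht
      have h1 := hbdd t ht
      have h2 : 2 * c + M / 2 ^ 0 ≤ (2 * c + M / 2 ^ 0) * Real.exp ((2 * C + 1) * t) :=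
        le_mul_of_one_le_right (by positivity) (hw ht.1)
      simp only [pow_zero, div_one] at h2 ⊢
      linarith
    | succ n ih =>
      intro t ht
      refine (step _ (by positivity) ih t ht).trans_eq ?_
      rw [pow_succ]
      ring
  intro t ht
  have hlim : Tendsto (fun n : ℕ => (2 * c + M / 2 ^ n) * Real.exp ((2 * C + 1) * t)) atTop
      (𝓝 ((2 * c + 0) * Real.exp ((2 * C + 1) * t))) :=
    ((tendsto_const_nhds.div_atTop (tendsto_pow_atTop_atTop_of_one_lt one_lt_two)).const_add
      _).mul_const _
  rw [add_zero] at hlim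
  exact ge_of_tendsto' hlim fun n => iter n t ht

/-- For a.e. `t`, the coefficients at time `t` only see the path up to time `t`. -/
theorem DocLip.nonanticipative {T : ℝ} {d : ℕ} {A : Type*} {f : ℝ → Path d → A → E d}
    {lam ell : ℝ → Path d → A → ℝ} {Lf : ℝ} (hD4 : DocLip T d f lam ell Lf) :
    ∀ᵐ t ∂(volume.restrict (Ioo (0 : ℝ) T)), ∀ y ∈ Cadlag T d, ∀ y' ∈ Cadlag T d,
      (∀ r ∈ Icc 0 t, y r = y' r) → ∀ a : A,
        lam t y a = lam t y' a ∧ ell t y a = ell t y' a := by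
  filter_upwards [hD4.2] with t ht y hy y' hy' heq a
  have h1 := ht y hy y' hy' a
  have h2 : sSup ((fun s => ‖y s - y' s‖) '' Icc 0 t) ≤ 0 := by
    refine Real.sSup_le ?_ le_rfl
    rintro _ ⟨r, hr, rfl⟩
    simp [heq r hr]
  have h3 := mul_nonpos_of_nonneg_of_nonpos hD4.1 h2
  have h4 := norm_nonneg (f t y a - f t y' a)
  have h5 := abs_nonneg (ell t y a - ell t y' a)
  have h6 := abs_nonneg (lam t y a - lam t y' a)
  exact ⟨sub_eq_zero.1 (abs_nonpos_iff.1 (by linarith)),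
    sub_eq_zero.1 (abs_nonpos_iff.1 (by linarith))⟩

/-- Trajectories with the same past and the same control up to time `b` coincide up to `b`. -/
theorem IsTraj.eqOn {T : ℝ} {d : ℕ} {A : Type*} {f : ℝ → Path d → A → E d}
    {lam ell : ℝ → Path d → A → ℝ} {Lf : ℝ} (hD4 : DocLip T d f lam ell Lf) {s b : ℝ}
    (hs : 0 ≤ s) (hsT : s ≤ T) (hb : b ≤ T) {x x' φ ψ : Path d} {α α' : ℝ → A}
    (hφ : IsTraj T d f s x α φ) (hψ : IsTraj T d f s x' α' ψ) (hx : x ∈ Cadlag T d)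
    (hx' : x' ∈ Cadlag T d) (hxx' : ∀ t ∈ Icc 0 s, x t = x' t)
    (hα : ∀ t ∈ Ioc s b, α t = α' t) : ∀ t ∈ Icc 0 b, φ t = ψ t := by
  have hφc := hφ.mem_cadlag hsT hx
  have hψc := hψ.mem_cadlag hsT hx'
  obtain ⟨M, hM0, hM⟩ := Cadlag.exists_norm_le hφc
  obtain ⟨M', hM0', hM'⟩ := Cadlag.exists_norm_le hψc
  have key := gronwall_path (u := fun t => ‖φ t - ψ t‖)
    (g := fun r => f r φ (α r) - f r ψ (α' r)) (s := s) (b := b) (c := 0) (M := M + M')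
    hD4.1 le_rfl (by positivity) (fun t ht => ?_) (fun t ht => ?_) (fun t ht => ?_) ?_
  · intro t ht
    have h1 := key t ht
    simp only [mul_zero, zero_mul] at h1
    exact sub_eq_zero.1 (norm_le_zero_iff.1 h1)
  · have htT : t ∈ Icc 0 T := ⟨ht.1, ht.2.trans hb⟩
    exact (norm_sub_le _ _).trans (add_le_add (hM t htT) (hM' t htT))
  · simp [hφ.1 t ht, hψ.1 t ht, hxx' t ht]
  · have htT : t ∈ Icc s T := ⟨ht.1, ht.2.trans hb⟩
    have hint {y : Path d} {γ : ℝ → A} {θ : Path d} (h : IsTraj T d f s y γ θ) :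
        IntervalIntegrable (fun r => f r θ (γ r)) volume s t :=
      (intervalIntegrable_iff_integrableOn_Icc_of_le ht.1).2
        (h.2.1.mono_set (Icc_subset_Icc_right htT.2))
    rw [zero_add, intervalIntegral.integral_sub (hint hφ) (hint hψ)]
    simp only [hφ.2.2 t htT, hψ.2.2 t htT, hxx' s ⟨hs, le_rfl⟩, add_sub_add_left_eq_sub, le_refl]
  · filter_upwards [ae_Ioc_of_ae_Ioo hD4.2 hs hb] with r hr hrs m hm hq
    rw [hα r hrs]
    have h1 := hr hrs φ hφc ψ hψc (α' r)
    have h2 : sSup ((fun s => ‖φ s - ψ s‖) '' Icc 0 r) ≤ m := by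
      refine Real.sSup_le ?_ hm
      rintro _ ⟨q, hq', rfl⟩
      exact hq q hq'
    have h3 := mul_le_mul_of_nonneg_left h2 hD4.1
    have h5 := abs_nonneg (ell r φ (α' r) - ell r ψ (α' r))
    have h6 := abs_nonneg (lam r φ (α' r) - lam r ψ (α' r))
    linarith

/-- Trajectories from a given initial path are bounded uniformly in the control. -/
theorem DocBound.exists_traj_norm_le {T : ℝ} {d : ℕ} {A : Type*} {f : ℝ → Path d → A → E d}
    {lam ell : ℝ → Path d → A → ℝ} {Cf Clam : ℝ} (hD3 : DocBound T d f lam ell Cf Clam) {s : ℝ}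
    (hs : 0 ≤ s) (hsT : s ≤ T) {x : Path d} (hx : x ∈ Cadlag T d) :
    ∃ R, 0 ≤ R ∧ ∀ (α : ℝ → A) (φ : Path d), IsTraj T d f s x α φ →
      ∀ t ∈ Icc 0 T, ‖φ t‖ ≤ R := by
  obtain ⟨R₀, hR₀, hxR⟩ := Cadlag.exists_norm_le hx
  have hT : 0 ≤ T := hs.trans hsT
  refine ⟨2 * (1 + R₀) * Real.exp ((2 * Cf + 1) * T), by positivity, fun α φ hφ t ht => ?_⟩
  have hφc := hφ.mem_cadlag hsT hx
  obtain ⟨M, hM0, hM⟩ := Cadlag.exists_norm_le hφc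
  have hCf := hD3.1
  have key := gronwall_path (u := fun t => 1 + ‖φ t‖) (g := fun r => f r φ (α r)) (s := s)
    (b := T) (c := 1 + R₀) (M := 1 + M) hCf (by positivity) (by positivity)
    (fun t ht => by linarith [hM t ht]) (fun t ht => ?_) (fun t ht => ?_) ?_ t ht
  · have : Real.exp ((2 * Cf + 1) * t) ≤ Real.exp ((2 * Cf + 1) * T) := by
      have := ht.2
      gcongr
    have := mul_le_mul_of_nonneg_left this (by positivity : 0 ≤ 2 * (1 + R₀))
    linarith
  · rw [hφ.1 t ht]
    linarith [hxR t ⟨ht.1, ht.2.trans hsT⟩]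
  · rw [hφ.2.2 t ht]
    have h1 := norm_add_le (x s) (∫ r in s..t, f r φ (α r))
    linarith [hxR s ⟨hs, hsT⟩]
  · filter_upwards [ae_Ioc_of_ae_Ioo hD3.2.2 hs le_rfl] with r hr hrs m hm hq
    have hr0 : 0 ≤ r := hs.trans hrs.1.le
    have h1 := (hr hrs φ hφc (α r)).1
    have h2 : runSup d φ r ≤ m - 1 := by
      refine Real.sSup_le ?_ ?_
      · rintro _ ⟨q, hq', rfl⟩
        linarith [hq q hq']
      · linarith [hq r ⟨hr0, le_rfl⟩, norm_nonneg (φ r)]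
    have h3 : Cf * (1 + runSup d φ r) ≤ Cf * m := mul_le_mul_of_nonneg_left (by linarith) hCf
    linarith [abs_nonneg (ell r φ (α r))]

/-- Bounds on the coefficients along a bounded path. -/
theorem DocBound.coeff_le {T : ℝ} {d : ℕ} {A : Type*} {f : ℝ → Path d → A → E d}
    {lam ell : ℝ → Path d → A → ℝ} {Cf Clam : ℝ} (hD3 : DocBound T d f lam ell Cf Clam)
    {φ : Path d} (hφ : φ ∈ Cadlag T d) {R : ℝ} (hR : 0 ≤ R) (hφR : ∀ t ∈ Icc 0 T, ‖φ t‖ ≤ R) :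
    ∀ᵐ t ∂(volume.restrict (Ioo (0 : ℝ) T)), ∀ a : A,
      ‖f t φ a‖ ≤ Cf * (1 + R) ∧ |ell t φ a| ≤ Cf * (1 + R) := by
  filter_upwards [hD3.2.2, ae_restrict_mem measurableSet_Ioo] with t ht htT a
  have h1 := (ht φ hφ a).1
  have h2 : runSup d φ t ≤ R := by
    refine Real.sSup_le ?_ hR
    rintro _ ⟨q, hq, rfl⟩
    exact hφR q ⟨hq.1, hq.2.trans htT.2.le⟩
  have h3 : Cf * (1 + runSup d φ t) ≤ Cf * (1 + R) :=
    mul_le_mul_of_nonneg_left (by linarith) hD3.1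
  constructor <;> linarith [abs_nonneg (ell t φ a), norm_nonneg (f t φ a)]

/-- Trajectories are Lipschitz after the initial time. -/
theorem IsTraj.dist_le {T : ℝ} {d : ℕ} {A : Type*} {f : ℝ → Path d → A → E d}
    {lam ell : ℝ → Path d → A → ℝ} {Cf Clam : ℝ} (hD3 : DocBound T d f lam ell Cf Clam) {s : ℝ}
    (hs : 0 ≤ s) {x φ : Path d} {α : ℝ → A} (hφ : IsTraj T d f s x α φ)
    (hφc : φ ∈ Cadlag T d) {R : ℝ} (hR : 0 ≤ R) (hφR : ∀ t ∈ Icc 0 T, ‖φ t‖ ≤ R) :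
    ∀ r ∈ Icc s T, ∀ t ∈ Icc s T, ‖φ r - φ t‖ ≤ Cf * (1 + R) * |r - t| := by
  intro r hr t ht
  have hint {t : ℝ} (ht : t ∈ Icc s T) :
      IntervalIntegrable (fun r => f r φ (α r)) volume s t :=
    (intervalIntegrable_iff_integrableOn_Icc_of_le ht.1).2
      (hφ.2.1.mono_set (Icc_subset_Icc_right ht.2))
  rw [hφ.2.2 r hr, hφ.2.2 t ht, add_sub_add_left_eq_sub,
    intervalIntegral.integral_interval_sub_left (hint hr) (hint ht)]
  refine intervalIntegral.norm_integral_le_of_norm_le_const_ae ?_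
  filter_upwards [ae_Ioc_of_ae_Ioo (hD3.coeff_le hφc hR hφR) le_rfl le_rfl] with q hq hqrt
  refine (hq ⟨?_, ?_⟩ (α q)).1
  · exact hs.trans_lt ((le_min ht.1 hr.1).trans_lt hqrt.1)
  · exact hqrt.2.trans (max_le ht.2 hr.2)

/-- The terminal cost depends only on the path up to time `T`. -/
theorem TermCont.congr {T : ℝ} {d : ℕ} {h : Path d → ℝ} (hh : TermCont T d h) {φ ψ : Path d}
    (hφ : φ ∈ Cadlag T d) (hψ : ψ ∈ Cadlag T d) (heq : ∀ t ∈ Icc 0 T, φ t = ψ t) :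
    h ψ = h φ := by
  refine eq_of_abs_sub_le_all fun ε hε => ?_
  obtain ⟨δ, hδ, H⟩ := hh φ hφ ε hε
  refine (H _ hψ (lt_of_le_of_lt (Real.sSup_le ?_ le_rfl) hδ)).le
  rintro _ ⟨r, hr, rfl⟩
  simp [heq r hr]

/-- The terminal cost is bounded on equi-Lipschitz bounded families with a common past. -/
theorem TermCont.exists_abs_le {T : ℝ} {d : ℕ} {h : Path d → ℝ} (hh : TermCont T d h) {s : ℝ}
    (hsT : s ≤ T) {x : Path d} (hx : x ∈ Cadlag T d) {L : ℝ} (hL : 0 ≤ L) (R : ℝ) :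
    ∃ B, ∀ φ ∈ Cadlag T d, (∀ t ∈ Icc 0 s, φ t = x t) →
      (∀ r ∈ Icc s T, ∀ t ∈ Icc s T, ‖φ r - φ t‖ ≤ L * |r - t|) →
      (∀ t ∈ Icc s T, ‖φ t‖ ≤ R) → |h φ| ≤ B := by
  classical
  let glue : BoundedContinuousFunction (Icc s T) (E d) → Path d :=
    fun g r => if r < s then x r else g (projIcc s T hsT r)
  have glue_cadlag (g) : glue g ∈ Cadlag T d := by
    refine Cadlag.of_continuousOn hx (s := s) (fun t ht => if_pos ht.2) ?_
    refine (g.continuous.comp (continuous_projIcc (h := hsT))).continuousOn.congr fun t ht => ?_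
    exact if_neg ht.1.not_gt
  have hcont : Continuous fun g => h (glue g) := by
    refine Metric.continuous_iff.2 fun g ε hε => ?_
    obtain ⟨δ, hδ, H⟩ := hh (glue g) (glue_cadlag g) ε hε
    refine ⟨δ, hδ, fun g' hg' => H _ (glue_cadlag g') (lt_of_le_of_lt ?_ hg')⟩
    refine Real.sSup_le ?_ dist_nonneg
    rintro _ ⟨r, -, rfl⟩
    by_cases hr : r < s
    · simp [glue, hr]
    · simp only [glue, if_neg hr]
      rw [← dist_eq_norm, dist_comm]
      exact BoundedContinuousFunction.dist_coe_le_dist _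
  let S : Set (BoundedContinuousFunction (Icc s T) (E d)) :=
    {g | (∀ r t : Icc s T, ‖g r - g t‖ ≤ L * |(r : ℝ) - t|) ∧ ∀ t, ‖g t‖ ≤ R}
  have hS : IsCompact (closure S) := by
    refine BoundedContinuousFunction.arzela_ascoli (Metric.closedBall 0 R)
      (isCompact_closedBall 0 R) S (fun g t hg => by simpa using hg.2 t) ?_
    refine (LipschitzWith.uniformEquicontinuous (K := L.toNNReal) _ fun g => ?_).equicontinuous
    refine LipschitzWith.of_dist_le_mul fun r t => ?_
    rw [dist_eq_norm, Real.coe_toNNReal L hL, Subtype.dist_eq, Real.dist_eq]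
    exact g.2.1 r t
  obtain ⟨B, hB⟩ := hS.exists_bound_of_continuousOn hcont.continuousOn
  refine ⟨B, fun φ hφ hpast hlip hbdd => ?_⟩
  have hφcont : Continuous fun t : Icc s T => φ t := by
    refine (LipschitzWith.of_dist_le_mul (K := L.toNNReal) fun r t => ?_).continuous
    rw [dist_eq_norm, Real.coe_toNNReal L hL, Subtype.dist_eq, Real.dist_eq]
    exact hlip r r.2 t t.2
  let g : BoundedContinuousFunction (Icc s T) (E d) :=
    BoundedContinuousFunction.mkOfCompact ⟨fun t => φ t, hφcont⟩
  have hgS : g ∈ S := ⟨fun r t => hlip r r.2 t t.2, fun t => hbdd t t.2⟩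
  have heq : h (glue g) = h φ := by
    refine hh.congr hφ (glue_cadlag g) fun r hr => ?_
    by_cases hrs : r < s
    · simp [glue, hrs, hpast r ⟨hr.1, hrs.le⟩]
    · simp [glue, if_neg hrs, g, projIcc_of_mem hsT ⟨not_lt.1 hrs, hr.2⟩]
  rw [← heq]
  exact hB g (subset_closure hgS)

/-- The running coefficients are integrable along càdlàg paths. -/
theorem integrableOn_coeff {T : ℝ} {d : ℕ} {A : Type*} [TopologicalSpace A] [MeasurableSpace A]
    [BorelSpace A] (hA : SigmaCompactMetrizable A) {f : ℝ → Path d → A → E d}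
    {lam ell : ℝ → Path d → A → ℝ} {Cf Clam : ℝ} (hD1 : DocCont T d f lam ell)
    (hD2 : DocMeas d f lam ell) (hD3 : DocBound T d f lam ell Cf Clam) {φ : Path d}
    (hφ : φ ∈ Cadlag T d) {α : ℝ → A} (hα : Measurable α) :
    IntegrableOn (fun r => lam r φ (α r)) (Ioo 0 T) ∧
      IntegrableOn (fun r => ell r φ (α r)) (Ioo 0 T) := by
  obtain ⟨R, hR, hφR⟩ := Cadlag.exists_norm_le hφ
  have hself : supDist T d φ φ ≤ 0 := by
    refine Real.sSup_le ?_ le_rfl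
    rintro _ ⟨r, -, rfl⟩
    simp
  have hcont : ∀ᵐ t ∂(volume.restrict (Ioo (0 : ℝ) T)),
      Continuous (lam t φ) ∧ Continuous (ell t φ) := by
    filter_upwards [hD1] with t ht
    simp only [continuous_iff_continuousAt, ContinuousAt, Metric.tendsto_nhds]
    refine ⟨fun a ε hε => ?_, fun a ε hε => ?_⟩ <;>
      obtain ⟨δ, hδ, U, hU, H⟩ := ht φ hφ a ε hε <;>
      filter_upwards [hU] with a' ha' <;>
      rw [dist_comm, Real.dist_eq]
    · exact (H φ hφ a' ha' (hself.trans_lt hδ)).2.1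
    · exact (H φ hφ a' ha' (hself.trans_lt hδ)).2.2
  have hlam := aestronglyMeasurable_caratheodory hA (hcont.mono fun _ h => h.1)
    (fun a => (hD2 φ a).2.1) hα
  have hell := aestronglyMeasurable_caratheodory hA (hcont.mono fun _ h => h.2)
    (fun a => (hD2 φ a).2.2) hα
  refine ⟨Integrable.of_bound hlam Clam ?_,
    Integrable.of_bound hell (Cf * (1 + R)) ?_⟩
  · filter_upwards [hD3.2.2] with t ht
    obtain ⟨-, h0, h1⟩ := ht φ hφ (α t)
    rwa [Real.norm_of_nonneg h0]
  · filter_upwards [hD3.coeff_le hφ hR hφR] with t ht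
    exact (ht (α t)).2

theorem intervalIntegrable_of_integrableOn_Ioo {T : ℝ} {g : ℝ → ℝ}
    (hg : IntegrableOn g (Ioo 0 T)) {a b : ℝ} (ha : 0 ≤ a) (hab : a ≤ b) (hb : b ≤ T) :
    IntervalIntegrable g volume a b :=
  (intervalIntegrable_iff_integrableOn_Ioo_of_le hab).2 (hg.mono_set (Ioo_subset_Ioo ha hb))

/-- The discount factor is at most `1`. -/
theorem chi_le_one {T : ℝ} {d : ℕ} {A : Type*} {f : ℝ → Path d → A → E d}
    {lam ell : ℝ → Path d → A → ℝ} {Cf Clam : ℝ} (hD3 : DocBound T d f lam ell Cf Clam)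
    {Φ : ℝ → Path d → (ℝ → A) → Path d} {s t : ℝ} (hs : 0 ≤ s) (hst : s ≤ t) (ht : t ≤ T)
    {x : Path d} {α : ℝ → A} (hΦ : Φ s x α ∈ Cadlag T d) : chi d lam Φ s x α t ≤ 1 := by
  refine Real.exp_le_one_iff.2 (neg_nonpos.2 ?_)
  rw [intervalIntegral.integral_of_le hst]
  refine integral_nonneg_of_ae ?_
  refine (ae_restrict_iff' measurableSet_Ioc).2 ?_
  filter_upwards [ae_Ioc_of_ae_Ioo hD3.2.2 hs ht] with r hr hrs
  exact (hr hrs _ hΦ (α r)).2.1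

/-- The cost functional is bounded below uniformly in the control. -/
theorem bddBelow_cost {T : ℝ} {d : ℕ} {A : Type*} [MeasurableSpace A]
    {f : ℝ → Path d → A → E d} {lam ell : ℝ → Path d → A → ℝ} {h : Path d → ℝ} {Cf Clam : ℝ}
    (hD3 : DocBound T d f lam ell Cf Clam) (hh : TermCont T d h)
    {Φ : ℝ → Path d → (ℝ → A) → Path d}
    (hΦ : ∀ s ∈ Icc (0 : ℝ) T, ∀ x ∈ Cadlag T d, ∀ α ∈ CtrlSet A,
      IsTraj T d f s x α (Φ s x α))
    {s : ℝ} (hs : 0 ≤ s) (hsT : s ≤ T) {x : Path d} (hx : x ∈ Cadlag T d) :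
    BddBelow ((fun α => cost T d lam ell h Φ s x α) '' CtrlSet A) := by
  obtain ⟨R, hR, hΦR⟩ := hD3.exists_traj_norm_le hs hsT hx
  have hL : 0 ≤ Cf * (1 + R) := mul_nonneg hD3.1 (by positivity)
  obtain ⟨B, hB⟩ := hh.exists_abs_le hsT hx hL R
  refine ⟨-(Cf * (1 + R) * |T - s| + B), ?_⟩
  rintro _ ⟨α, hα, rfl⟩
  have htraj := hΦ s ⟨hs, hsT⟩ x hx α hα
  have hφ := htraj.mem_cadlag hsT hx
  have hφR := hΦR α _ htraj
  have hhB : |h (Φ s x α)| ≤ B :=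
    hB _ hφ htraj.1 (htraj.dist_le hD3 hs hφ hR hφR) fun t ht => hφR t ⟨hs.trans ht.1, ht.2⟩
  have hpos (t : ℝ) : 0 < chi d lam Φ s x α t := Real.exp_pos _
  have h1 : ‖∫ t in s..T, chi d lam Φ s x α t * ell t (Φ s x α) (α t)‖ ≤
      Cf * (1 + R) * |T - s| := by
    refine intervalIntegral.norm_integral_le_of_norm_le_const_ae ?_
    rw [uIoc_of_le hsT]
    filter_upwards [ae_Ioc_of_ae_Ioo (hD3.coeff_le hφ hR hφR) hs le_rfl] with r hr hrs
    rw [norm_mul, Real.norm_of_nonneg (hpos r).le, Real.norm_eq_abs]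
    calc _ ≤ 1 * (Cf * (1 + R)) := mul_le_mul (chi_le_one hD3 hs hrs.1.le hrs.2 hφ)
          (hr hrs (α r)).2 (abs_nonneg _) zero_le_one
      _ = _ := one_mul _
  have h2 : |chi d lam Φ s x α T * h (Φ s x α)| ≤ B := by
    rw [abs_mul, abs_of_pos (hpos T)]
    calc _ ≤ 1 * |h (Φ s x α)| :=
          mul_le_mul_of_nonneg_right (chi_le_one hD3 hs hsT le_rfl hφ) (abs_nonneg _)
      _ ≤ B := by rwa [one_mul]
  have h3 := neg_le_of_abs_le h2
  have h4 := neg_le_of_abs_le h1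
  simp only [cost]
  linarith

/-- Cost of the concatenation of the control `α` up to time `t` with `β` afterwards. -/
theorem cost_concat {T : ℝ} {d : ℕ} {A : Type*} [TopologicalSpace A] [MeasurableSpace A]
    [BorelSpace A] (hA : SigmaCompactMetrizable A) {f : ℝ → Path d → A → E d}
    {lam ell : ℝ → Path d → A → ℝ} {h : Path d → ℝ} {Cf Clam Lf : ℝ}
    (hD1 : DocCont T d f lam ell) (hD2 : DocMeas d f lam ell)
    (hD3 : DocBound T d f lam ell Cf Clam) (hD4 : DocLip T d f lam ell Lf)
    (hh : TermCont T d h) {Φ : ℝ → Path d → (ℝ → A) → Path d}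
    (hΦ : ∀ s ∈ Icc (0 : ℝ) T, ∀ x ∈ Cadlag T d, ∀ α ∈ CtrlSet A,
      IsTraj T d f s x α (Φ s x α))
    {s t : ℝ} (hs : 0 ≤ s) (hst : s ≤ t) (htT : t ≤ T) {x : Path d} (hx : x ∈ Cadlag T d)
    {α β γ : ℝ → A} (hα : α ∈ CtrlSet A) (hβ : β ∈ CtrlSet A) (hγ : γ ∈ CtrlSet A)
    (hγα : ∀ r ≤ t, γ r = α r) (hγβ : ∀ r, t < r → γ r = β r) :
    cost T d lam ell h Φ s x γ =
      (∫ r in s..t, chi d lam Φ s x α r * ell r (Φ s x α) (α r)) +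
        chi d lam Φ s x α t * cost T d lam ell h Φ t (Φ s x α) β := by
  have hsT := hst.trans htT
  have ht := hs.trans hst
  have hφ := hΦ s ⟨hs, hsT⟩ x hx α hα
  have hψ := hΦ s ⟨hs, hsT⟩ x hx γ hγ
  have hφc := hφ.mem_cadlag hsT hx
  have hψc := hψ.mem_cadlag hsT hx
  have hθ := hΦ t ⟨ht, htT⟩ _ hφc β hβ
  have hθc := hθ.mem_cadlag htT hφc
  have hψφ : ∀ r ∈ Icc 0 t, Φ s x γ r = Φ s x α r :=
    hψ.eqOn hD4 hs hsT htT hφ hx hx (fun _ _ => rfl) fun r hr => hγα r hr.2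
  have hψrestart : IsTraj T d f t (Φ s x γ) γ (Φ s x γ) := by
    have hint {r : ℝ} (hr : r ∈ Icc s T) :
        IntervalIntegrable (fun q => f q (Φ s x γ) (γ q)) volume s r :=
      (intervalIntegrable_iff_integrableOn_Icc_of_le hr.1).2
        (hψ.2.1.mono_set (Icc_subset_Icc_right hr.2))
    refine ⟨fun _ _ => rfl, hψ.2.1.mono_set (Icc_subset_Icc_left hst), fun r hr => ?_⟩
    have hr' : r ∈ Icc s T := ⟨hst.trans hr.1, hr.2⟩
    rw [hψ.2.2 r hr', hψ.2.2 t ⟨hst, htT⟩, add_assoc,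
      ← intervalIntegral.integral_interval_sub_left (hint hr') (hint ⟨hst, htT⟩), add_sub_cancel]
  have hψθ : ∀ r ∈ Icc 0 T, Φ s x γ r = Φ t (Φ s x α) β r :=
    hψrestart.eqOn hD4 ht htT le_rfl hθ hψc hφc hψφ fun r hr => hγβ r hr.1
  obtain ⟨hlam, hell⟩ := integrableOn_coeff hA hD1 hD2 hD3 hψc hγ
  have hbefore : ∀ᵐ r, r ∈ Ioc s t →
      lam r (Φ s x γ) (γ r) = lam r (Φ s x α) (α r) ∧
        ell r (Φ s x γ) (γ r) = ell r (Φ s x α) (α r) := by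
    filter_upwards [ae_Ioc_of_ae_Ioo hD4.nonanticipative hs htT] with r hr hrs
    rw [hγα r hrs.2]
    exact hr hrs _ hψc _ hφc (fun q hq => hψφ q ⟨hq.1, hq.2.trans hrs.2⟩) _
  have hafter : ∀ᵐ r, r ∈ Ioc t T →
      lam r (Φ s x γ) (γ r) = lam r (Φ t (Φ s x α) β) (β r) ∧
        ell r (Φ s x γ) (γ r) = ell r (Φ t (Φ s x α) β) (β r) := by
    filter_upwards [ae_Ioc_of_ae_Ioo hD4.nonanticipative ht le_rfl] with r hr hrs
    rw [hγβ r hrs.1]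
    exact hr hrs _ hψc _ hθc (fun q hq => hψθ q ⟨hq.1, hq.2.trans hrs.2⟩) _
  have hchi_before : ∀ r ∈ Icc s t, chi d lam Φ s x γ r = chi d lam Φ s x α r := by
    intro r hr
    simp only [chi]
    congr 2
    refine intervalIntegral.integral_congr_ae ?_
    rw [uIoc_of_le hr.1]
    filter_upwards [hbefore] with q hq hqr
    exact (hq ⟨hqr.1, hqr.2.trans hr.2⟩).1
  have hchi_after : ∀ r ∈ Icc t T, chi d lam Φ s x γ r =
      chi d lam Φ s x α t * chi d lam Φ t (Φ s x α) β r := by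
    intro r hr
    rw [← hchi_before t ⟨hst, le_rfl⟩]
    simp only [chi]
    rw [← Real.exp_add, ← neg_add,
      ← intervalIntegral.integral_add_adjacent_intervals
        (intervalIntegrable_of_integrableOn_Ioo hlam hs hst htT)
        (intervalIntegrable_of_integrableOn_Ioo hlam ht hr.1 hr.2)]
    congr 3
    refine intervalIntegral.integral_congr_ae ?_
    rw [uIoc_of_le hr.1]
    filter_upwards [hafter] with q hq hqr
    exact (hq ⟨hqr.1, hqr.2.trans hr.2⟩).1
  have hchi_cont : ContinuousOn (chi d lam Φ s x γ) (uIcc s T) :=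
    (intervalIntegral.continuousOn_primitive_interval'
      (intervalIntegrable_of_integrableOn_Ioo hlam hs hsT le_rfl) left_mem_uIcc).neg.rexp
  have hint : IntervalIntegrable
      (fun r => chi d lam Φ s x γ r * ell r (Φ s x γ) (γ r)) volume s T :=
    (intervalIntegrable_of_integrableOn_Ioo hell hs hsT le_rfl).continuousOn_mul hchi_cont
  have hmem : t ∈ uIcc s T := by rw [uIcc_of_le hsT]; exact ⟨hst, htT⟩
  have hI1 : ∫ r in s..t, chi d lam Φ s x γ r * ell r (Φ s x γ) (γ r) =
      ∫ r in s..t, chi d lam Φ s x α r * ell r (Φ s x α) (α r) := by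
    refine intervalIntegral.integral_congr_ae ?_
    rw [uIoc_of_le hst]
    filter_upwards [hbefore] with r hr hrs
    rw [(hr hrs).2, hchi_before r ⟨hrs.1.le, hrs.2⟩]
  have hI2 : ∫ r in t..T, chi d lam Φ s x γ r * ell r (Φ s x γ) (γ r) =
      chi d lam Φ s x α t * ∫ r in t..T, chi d lam Φ t (Φ s x α) β r *
        ell r (Φ t (Φ s x α) β) (β r) := by
    rw [← intervalIntegral.integral_const_mul]
    refine intervalIntegral.integral_congr_ae ?_
    rw [uIoc_of_le htT]
    filter_upwards [hafter] with r hr hrs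
    rw [(hr hrs).2, hchi_after r ⟨hrs.1.le, hrs.2⟩, mul_assoc]
  simp only [cost]
  rw [← intervalIntegral.integral_add_adjacent_intervals
      (hint.mono_set (uIcc_subset_uIcc_left hmem)) (hint.mono_set (uIcc_subset_uIcc_right hmem)),
    hI1, hI2, hchi_after T ⟨htT, le_rfl⟩, hh.congr hθc hψc fun r hr => (hψθ r hr).symm]
  ring

/-- Dynamic programming principle for the value function. -/
theorem value_dpp (T : ℝ) (hT : 0 < T) (d : ℕ) (hd : 1 ≤ d)
    (A : Type*) [TopologicalSpace A] [MeasurableSpace A] [BorelSpace A] [Nonempty A]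
    (hA : SigmaCompactMetrizable A)
    (f : ℝ → Path d → A → E d) (lam ell : ℝ → Path d → A → ℝ) (h : Path d → ℝ)
    (Cf Clam Lf : ℝ)
    (hD1 : DocCont T d f lam ell) (hD2 : DocMeas d f lam ell)
    (hD3 : DocBound T d f lam ell Cf Clam) (hD4 : DocLip T d f lam ell Lf)
    (hh : TermCont T d h)
    (Φ : ℝ → Path d → (ℝ → A) → Path d)
    (hΦ : ∀ s ∈ Icc (0 : ℝ) T, ∀ x ∈ Cadlag T d, ∀ α ∈ CtrlSet A,
      IsTraj T d f s x α (Φ s x α))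
    (s t : ℝ) (hs : 0 ≤ s) (hst : s ≤ t) (htT : t ≤ T)
    (x : Path d) (hx : x ∈ Cadlag T d) :
    value T d A lam ell h Φ s x =
      sInf ((fun α => (∫ r in s..t, chi d lam Φ s x α r * ell r (Φ s x α) (α r)) +
        chi d lam Φ s x α t * value T d A lam ell h Φ t (Φ s x α)) '' CtrlSet A) := by
  classical
  have hsT := hst.trans htT
  have ht := hs.trans hst
  have hne : (CtrlSet A).Nonempty := ⟨fun _ => Classical.arbitrary A, measurable_const⟩
  have hbdd := bddBelow_cost hD3 hh hΦ hs hsT hx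
  have hlower : ∀ α ∈ CtrlSet A, value T d A lam ell h Φ s x ≤
      (∫ r in s..t, chi d lam Φ s x α r * ell r (Φ s x α) (α r)) +
        chi d lam Φ s x α t * value T d A lam ell h Φ t (Φ s x α) := by
    intro α hα
    have hpos : 0 < chi d lam Φ s x α t := Real.exp_pos _
    rw [← sub_le_iff_le_add', ← div_le_iff₀' hpos]
    refine le_csInf (hne.image _) ?_
    rintro _ ⟨β, hβ, rfl⟩
    rw [div_le_iff₀' hpos, sub_le_iff_le_add']
    have hγ : (fun r => if r ≤ t then α r else β r) ∈ CtrlSet A :=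
      Measurable.ite measurableSet_Iic hα hβ
    refine (csInf_le hbdd (mem_image_of_mem _ hγ)).trans_eq ?_
    exact cost_concat hA hD1 hD2 hD3 hD4 hh hΦ hs hst htT hx hα hβ hγ
      (fun r hr => if_pos hr) fun r hr => if_neg hr.not_ge
  refine le_antisymm (le_csInf (hne.image _) ?_) (le_csInf (hne.image _) ?_)
  · rintro _ ⟨α, hα, rfl⟩
    exact hlower α hα
  · rintro _ ⟨α, hα, rfl⟩
    have hφ := (hΦ s ⟨hs, hsT⟩ x hx α hα).mem_cadlag hsT hx
    refine (csInf_le ⟨value T d A lam ell h Φ s x, ?_⟩ (mem_image_of_mem _ hα)).trans ?_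
    · rintro _ ⟨β, hβ, rfl⟩
      exact hlower β hβ
    · have hle := csInf_le (bddBelow_cost hD3 hh hΦ ht htT hφ) (mem_image_of_mem _ hα)
      have hsplit := cost_concat hA hD1 hD2 hD3 hD4 hh hΦ hs hst htT hx hα hα hα
        (fun _ _ => rfl) fun _ _ => rfl
      simp only [hsplit]
      exact (add_le_add_iff_left _).2 (mul_le_mul_of_nonneg_left hle (Real.exp_pos _).le)

end PHJ
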